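/- Let q ≥ 3, let V and W be real vector spaces with dim V = q + 1 and dim W = q, and let δ : V × V → W be an alternating bilinear map such that: (i) δ has no nonzero degree-zero vectors, i.e. for every nonzero x ∈ V there is y ∈ V with δ(x, y) ≠ 0; (ii) the image of δ spans W; and (iii) there is a q-dimensional subspace B ⊂ V such that the singular elements of V are exactly the nonzero elements of B (a nonzero x has deg(x) < max_{v} deg(v) if and only if x ∈ B). Then the following are equivalent: (a) every nonzero b ∈ B has degree one, i.e. dim(range Δ_b) = 1; (b) δ vanishes identically on B, i.e. δ(b, b′) = 0 for all b, b′ ∈ B. (Pointwise linear-algebra content of the equivalence (2) ⇔ (3) of Proposition 2.7 on integrable Weber structures.) -/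

import Mathlib

open Module LinearMap

/-- A subspace of codimension one is complemented by a line. -/
lemma Submodule.exists_forall_add_smul_of_finrank {K V : Type*} [Field K] [AddCommGroup V]
    [Module K V] [FiniteDimensional K V] (B : Submodule K V)
    (hB : Module.finrank K V = Module.finrank K B + 1) :
    ∃ x : V, ∀ v : V, ∃ b ∈ B, ∃ c : K, v = b + c • x := by
  have hlt : B < ⊤ := lt_top_iff_ne_top.2 fun h => by
    rw [h, finrank_top] at hB
    omega
  obtain ⟨x, -, hx⟩ := SetLike.exists_of_lt hlt
  have htop : B ⊔ Submodule.span K {x} = ⊤ := by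
    apply Submodule.eq_top_of_finrank_eq
    have h1 : B < B ⊔ Submodule.span K {x} := by
      refine lt_of_le_of_ne le_sup_left fun h => hx ?_
      rw [h]
      exact Submodule.mem_sup_right (Submodule.mem_span_singleton_self x)
    have h2 := Submodule.finrank_lt_finrank_of_lt h1
    have h3 := Submodule.finrank_le (B ⊔ Submodule.span K {x})
    omega
  refine ⟨x, fun v => ?_⟩
  have hv : v ∈ B ⊔ Submodule.span K {x} := htop ▸ Submodule.mem_top
  obtain ⟨b, hb, y, hy, rfl⟩ := Submodule.mem_sup.1 hv
  obtain ⟨c, rfl⟩ := Submodule.mem_span_singleton.1 hy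
  exact ⟨b, hb, c, rfl⟩

/-- A line containing a nonzero vector is spanned by it. -/
lemma Submodule.eq_span_singleton_of_finrank_eq_one {K W : Type*} [Field K] [AddCommGroup W]
    [Module K W] {L : Submodule K W} (hL : Module.finrank K L = 1) {w : W} (hw : w ∈ L)
    (hw0 : w ≠ 0) : L = Submodule.span K {w} := by
  have : FiniteDimensional K L := Module.finite_of_finrank_eq_succ hL
  refine (Submodule.eq_of_le_of_finrank_eq ?_ ?_).symm
  · rwa [Submodule.span_singleton_le_iff_mem]
  · rw [hL, finrank_span_singleton hw0]

/-- Pointwise linear-algebra content of the equivalence (2) ⇔ (3) of Proposition 2.7 on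
integrable Weber structures.  Let `q ≥ 3`, `dim V = q + 1`, `dim W = q`, and let
`δ : V × V → W` be an alternating bilinear map such that: (i) `δ` has no nonzero degree-zero
vectors; (ii) the image of `δ` spans `W`; (iii) there is a `q`-dimensional subspace `B ⊂ V`
whose nonzero elements are exactly the singular elements of `V`.  Then every nonzero `b ∈ B`
has degree one if and only if `δ` vanishes identically on `B`. -/
theorem weber_degree_one_iff_vanishes {V W : Type*}
    [AddCommGroup V] [Module ℝ V] [AddCommGroup W] [Module ℝ W]
    [FiniteDimensional ℝ V] [FiniteDimensional ℝ W]
    (q : ℕ) (hq : 3 ≤ q)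
    (hV : Module.finrank ℝ V = q + 1) (hW : Module.finrank ℝ W = q)
    (δ : V →ₗ[ℝ] V →ₗ[ℝ] W) (hδ : ∀ x : V, δ x x = 0)
    (hnondeg : ∀ x : V, x ≠ 0 → ∃ y : V, δ x y ≠ 0)
    (hspan : Submodule.span ℝ {w : W | ∃ x y : V, δ x y = w} = ⊤)
    (B : Submodule ℝ V) (hB : Module.finrank ℝ B = q)
    (hsing : ∀ x : V, x ≠ 0 →
      (Module.finrank ℝ (LinearMap.range (δ x)) <
          ⨆ v : V, Module.finrank ℝ (LinearMap.range (δ v)) ↔ x ∈ B)) :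
    (∀ b ∈ B, b ≠ 0 → Module.finrank ℝ (LinearMap.range (δ b)) = 1) ↔
      (∀ b ∈ B, ∀ b' ∈ B, δ b b' = 0) := by
  obtain ⟨x, hx⟩ := B.exists_forall_add_smul_of_finrank (by rw [hV, hB])
  have hneg (u v : V) : δ u v = -δ v u := ((show δ.IsAlt from hδ).neg v u).symm
  constructor
  · intro h b₁ hb₁ b₂ hb₂
    by_contra hw
    have hline (b : V) (hb : b ∈ B) (y : V) (hy : δ b y ≠ 0) :
        LinearMap.range (δ b) = Submodule.span ℝ {δ b y} :=
      Submodule.eq_span_singleton_of_finrank_eq_one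
        (h b hb fun h0 => hy (by simp [h0])) ⟨y, rfl⟩ hy
    have hrange₁ := hline b₁ hb₁ b₂ hw
    have hw' : δ b₂ b₁ ≠ 0 := by rwa [hneg, neg_ne_zero]
    have hrange₂ : LinearMap.range (δ b₂) = Submodule.span ℝ {δ b₁ b₂} := by
      rw [hline b₂ hb₂ b₁ hw', hneg b₂ b₁, ← Set.neg_singleton, Submodule.span_neg]
    have hmeet (b : V) (hb : b ∈ B) (b' : V) (hb' : b' ∈ B) (hne : δ b b' ≠ 0)
        (hr : LinearMap.range (δ b') = Submodule.span ℝ {δ b₁ b₂}) :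
        LinearMap.range (δ b) = Submodule.span ℝ {δ b₁ b₂} := by
      have hne' : δ b' b ≠ 0 := by rwa [hneg, neg_ne_zero]
      rw [hline b hb b' hne, ← hr, hline b' hb' b hne', hneg b b', ← Set.neg_singleton,
        Submodule.span_neg]
    have hall (b : V) (hb : b ∈ B) (y : V) : δ b y ∈ Submodule.span ℝ {δ b₁ b₂} := by
      by_cases h2 : δ b b₂ = 0
      · have hsum := hmeet (b + b₁) (B.add_mem hb hb₁) b₂ hb₂ (by simpa [h2] using hw) hrange₂
        have hy : δ b y = δ (b + b₁) y - δ b₁ y := by simp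
        rw [hy]
        exact Submodule.sub_mem _ (hsum ▸ ⟨y, rfl⟩) (hrange₁ ▸ ⟨y, rfl⟩)
      · exact hmeet b hb b₂ hb₂ h2 hrange₂ ▸ ⟨y, rfl⟩
    have htop : (⊤ : Submodule ℝ W) ≤ Submodule.span ℝ {δ b₁ b₂} := by
      rw [← hspan, Submodule.span_le]
      rintro _ ⟨u, v, rfl⟩
      obtain ⟨b, hb, c, rfl⟩ := hx u
      obtain ⟨b', hb', c', rfl⟩ := hx v
      have hexp : δ (b + c • x) (b' + c' • x) = δ b (b' + c' • x) - c • δ b' x := by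
        simp [hδ, hneg x b', sub_eq_add_neg]
      rw [hexp]
      exact Submodule.sub_mem _ (hall b hb _) (Submodule.smul_mem _ c (hall b' hb' x))
    have hle := Submodule.finrank_mono htop
    rw [finrank_top, hW, finrank_span_singleton hw] at hle
    omega
  · intro h b hb hb0
    obtain ⟨y, hy⟩ := hnondeg b hb0
    have hval (b' : V) (hb' : b' ∈ B) (c : ℝ) : δ b (b' + c • x) = c • δ b x := by
      simp [h b hb b' hb']
    have hbx : δ b x ≠ 0 := by
      intro h0
      obtain ⟨b', hb', c, rfl⟩ := hx y
      exact hy (by rw [hval b' hb', h0, smul_zero])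
    have hr : LinearMap.range (δ b) = Submodule.span ℝ {δ b x} := by
      apply le_antisymm
      · rintro _ ⟨v, rfl⟩
        obtain ⟨b', hb', c, rfl⟩ := hx v
        rw [hval b' hb']
        exact Submodule.smul_mem _ c (Submodule.mem_span_singleton_self _)
      · rw [Submodule.span_singleton_le_iff_mem]
        exact ⟨x, rfl⟩
    rw [hr, finrank_span_singleton hbx]
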